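/- Let A be a noetherian local domain of Krull dimension 1 with fraction field K, let B be an integral domain containing A that is finitely generated as an A-module, with fraction field L, and let g ∈ A be nonzero. Then length_A(B/gB) = [L : K] · length_A(A/gA), both lengths being finite. -/

import Mathlib

/-- The length of a module, i.e. the height of the top element of its lattice of submodules. -/
noncomputable def moduleLength (R : Type*) [Ring R] (M : Type*) [AddCommGroup M] [Module R M] :
    ℕ∞ :=
  Order.height (⊤ : Submodule R M)

open Module in
lemma aux_length_comp {R N M P : Type*} [CommRing R] [AddCommGroup N] [AddCommGroup M]
    [AddCommGroup P] [Module R N] [Module R M] [Module R P] (f : N →ₗ[R] M)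
    (hf : Function.Injective f) (h : P →ₗ[R] N) :
    Module.length R (M ⧸ LinearMap.range (f ∘ₗ h)) =
      Module.length R (N ⧸ LinearMap.range h) + Module.length R (M ⧸ LinearMap.range f) := by
  have h1 : LinearMap.range h ≤ (LinearMap.range (f ∘ₗ h)).comap f := by
    rintro _ ⟨x, rfl⟩
    exact ⟨x, rfl⟩
  have h2 : LinearMap.range (f ∘ₗ h) ≤ LinearMap.range f := LinearMap.range_comp_le_range _ _
  refine Module.length_eq_add_of_exact (Submodule.mapQ _ _ f h1) (Submodule.factor h2) ?_
    (Submodule.factor_surjective h2) ?_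
  · rw [← LinearMap.ker_eq_bot, LinearMap.ker_eq_bot']
    intro x hx
    obtain ⟨x, rfl⟩ := Submodule.mkQ_surjective _ x
    simp only [Submodule.mkQ_apply, Submodule.mapQ_apply, Submodule.Quotient.mk_eq_zero] at hx ⊢
    obtain ⟨p, hp⟩ := hx
    exact ⟨p, hf hp⟩
  · intro x
    obtain ⟨x, rfl⟩ := Submodule.mkQ_surjective _ x
    constructor
    · intro hx
      have hx' : x ∈ LinearMap.range f := by
        simpa [Submodule.factor_mk, Submodule.Quotient.mk_eq_zero] using hx
      obtain ⟨y, rfl⟩ := hx'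
      exact ⟨Submodule.Quotient.mk y, rfl⟩
    · rintro ⟨y, hy⟩
      obtain ⟨y, rfl⟩ := Submodule.mkQ_surjective _ y
      rw [← hy]
      simp only [Submodule.mkQ_apply, Submodule.mapQ_apply, Submodule.factor_mk,
        Submodule.Quotient.mk_eq_zero]
      exact ⟨y, rfl⟩

lemma aux_length_ne_top {A C : Type*} [CommRing A] [IsNoetherianRing A]
    [Ring.KrullDimLE 1 A] [AddCommGroup C] [Module A C] [Module.Finite A C]
    (h : Module.IsTorsion A C) : Module.length A C ≠ ⊤ := by
  obtain ⟨a, ha, ha0⟩ := Submodule.annihilator_top_inter_nonZeroDivisors h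
  have hfl := isFiniteLength_quotient_span_singleton A ha0
  obtain ⟨n, φ, hφ⟩ := Module.Finite.exists_fin' A C
  have key : ∀ i : Fin n, Ideal.span {a} ≤
      LinearMap.ker (φ ∘ₗ LinearMap.single A (fun _ => A) i) := by
    intro i
    rw [Ideal.span_le, Set.singleton_subset_iff]
    have : LinearMap.single A (fun _ : Fin n => A) i a =
        a • LinearMap.single A (fun _ : Fin n => A) i 1 := by
      rw [← map_smul, smul_eq_mul, mul_one]
    simp only [SetLike.mem_coe, LinearMap.mem_ker, LinearMap.comp_apply]
    rw [this, map_smul]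
    exact Submodule.mem_annihilator.mp ha _ trivial
  let ψ : (Fin n → A ⧸ Ideal.span {a}) →ₗ[A] C :=
    LinearMap.lsum A (fun _ => A ⧸ Ideal.span {a}) A
      (fun i => (Ideal.span {a}).liftQ _ (key i))
  have hψ : Function.Surjective ψ := by
    intro c
    obtain ⟨x, rfl⟩ := hφ c
    refine ⟨fun i => Submodule.Quotient.mk (x i), ?_⟩
    simp only [ψ, LinearMap.lsum_apply, LinearMap.sum_apply, LinearMap.comp_apply,
      LinearMap.proj_apply, Submodule.liftQ_apply]
    rw [← map_sum]
    congr 1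
    simp [LinearMap.single_apply, Finset.univ_sum_single]
  refine ne_top_of_le_ne_top ?_ (Module.length_le_of_surjective ψ hψ)
  rw [isFiniteLength_iff_isNoetherian_isArtinian] at hfl
  have := hfl.1
  have := hfl.2
  exact Module.length_ne_top

lemma aux_length_pi {A : Type*} [CommRing A] (g : A) (n : ℕ) :
    Module.length A ((Fin n → A) ⧸ LinearMap.range (LinearMap.lsmul A (Fin n → A) g)) =
      n * Module.length A (A ⧸ Ideal.span {g}) := by
  let φ : (Fin n → A) →ₗ[A] (Fin n → A ⧸ Ideal.span {g}) :=
    LinearMap.pi fun i => (Ideal.span {g}).mkQ ∘ₗ LinearMap.proj i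
  have hφ : Function.Surjective φ := by
    intro y
    choose x hx using fun i => Submodule.mkQ_surjective _ (y i)
    exact ⟨x, funext hx⟩
  have hk : LinearMap.range (LinearMap.lsmul A (Fin n → A) g) = LinearMap.ker φ := by
    ext x
    have : x ∈ LinearMap.ker φ ↔ ∀ i, x i ∈ Ideal.span {g} := by
      rw [LinearMap.mem_ker, funext_iff]
      exact forall_congr' fun i => Submodule.Quotient.mk_eq_zero _
    rw [this]
    constructor
    · rintro ⟨y, rfl⟩ i
      exact Ideal.mem_span_singleton'.mpr ⟨y i, by simp [mul_comm]⟩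
    · intro h
      choose y hy using fun i => Ideal.mem_span_singleton'.mp (h i)
      exact ⟨y, funext fun i => by simp [← hy i, mul_comm]⟩
  rw [hk, (φ.quotKerEquivOfSurjective hφ).length_eq, Module.length_pi]
  simp

/-- Let `A` be a noetherian local domain of Krull dimension 1 with fraction field `K`, and
`B ⊇ A` a module-finite domain extension with fraction field `L`. For nonzero `g ∈ A`,
`length_A (B/gB) = [L : K] · length_A (A/gA)`, both lengths being finite. -/
theorem length_quotient_algebraMap_eq_degree_mul_length
    (A : Type*) [CommRing A] [IsDomain A] [IsNoetherianRing A] [IsLocalRing A]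
    (hdim : ringKrullDim A = 1)
    (B : Type*) [CommRing B] [IsDomain B] [Algebra A B] [Module.Finite A B]
    (hinj : Function.Injective (algebraMap A B))
    (K : Type*) [Field K] [Algebra A K] [IsFractionRing A K]
    (L : Type*) [Field L] [Algebra B L] [IsFractionRing B L]
    [Algebra A L] [IsScalarTower A B L]
    [Algebra K L] [IsScalarTower A K L]
    (g : A) (hg : g ≠ 0) :
    moduleLength A (B ⧸ Ideal.span {algebraMap A B g}) ≠ ⊤ ∧
    moduleLength A (A ⧸ Ideal.span {g}) ≠ ⊤ ∧
    moduleLength A (B ⧸ Ideal.span {algebraMap A B g}) =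
      (Module.finrank K L : ℕ∞) * moduleLength A (A ⧸ Ideal.span {g}) := by
  have : Ring.KrullDimLE 1 A := Ring.krullDimLE_iff.mpr hdim.le
  have hA : Module.length A (A ⧸ Ideal.span {g}) ≠ ⊤ :=
    Module.length_ne_top_iff.mpr
      (isFiniteLength_quotient_span_singleton A (mem_nonZeroDivisors_of_ne_zero hg))
  obtain ⟨n, hn⟩ : ∃ n, n = Module.finrank A B := ⟨_, rfl⟩
  obtain ⟨v, hv⟩ := exists_linearIndependent_of_le_finrank hn.le
  let f : (Fin n → A) →ₗ[A] B := Fintype.linearCombination A v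
  have hf : Function.Injective f := hv.fintypeLinearCombination_injective
  have hC : Module.length A (B ⧸ LinearMap.range f) ≠ ⊤ := by
    apply aux_length_ne_top
    rw [← Module.finrank_eq_zero_iff_isTorsion]
    have h1 := (LinearMap.range f).finrank_quotient_add_finrank
    rw [LinearMap.finrank_range_of_inj hf, Module.finrank_fin_fun] at h1
    omega
  have hgB : Function.Injective (LinearMap.lsmul A B g) := by
    intro x y hxy
    simp only [LinearMap.lsmul_apply, Algebra.smul_def] at hxy
    exact mul_left_cancel₀ (by rwa [Ne, map_eq_zero_iff _ hinj]) hxy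
  have e1 := aux_length_comp f hf (LinearMap.lsmul A (Fin n → A) g)
  have e2 := aux_length_comp (LinearMap.lsmul A B g) hgB f
  have hcomm : f ∘ₗ LinearMap.lsmul A (Fin n → A) g = LinearMap.lsmul A B g ∘ₗ f := by
    ext; simp
  rw [hcomm, e2, aux_length_pi, add_comm] at e1
  have e3 := WithTop.add_right_cancel hC e1
  have e4 : Module.length A (B ⧸ Ideal.span {algebraMap A B g}) =
      Module.length A (B ⧸ LinearMap.range (LinearMap.lsmul A B g)) := by
    have hr : LinearMap.range (LinearMap.lsmul A B g) =
        (Ideal.span {algebraMap A B g}).restrictScalars A := by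
      ext x
      simp [Ideal.mem_span_singleton', Algebra.smul_def, mul_comm]
    rw [hr]
    exact (Submodule.Quotient.restrictScalarsEquiv A _).symm.length_eq
  have e5 : Module.length A (B ⧸ Ideal.span {algebraMap A B g}) =
      (Module.finrank K L : ℕ∞) * Module.length A (A ⧸ Ideal.span {g}) := by
    rw [e4, e3, IsFractionRing.finrank_eq A K B L, hn]
  have hB' : moduleLength A (B ⧸ Ideal.span {algebraMap A B g}) =
      Module.length A (B ⧸ Ideal.span {algebraMap A B g}) := (Module.length_eq_height A _).symm
  have hA' : moduleLength A (A ⧸ Ideal.span {g}) =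
      Module.length A (A ⧸ Ideal.span {g}) := (Module.length_eq_height A _).symm
  rw [hB', hA']
  refine ⟨?_, hA, e5⟩
  rw [e5]
  exact WithTop.mul_ne_top (ENat.natCast_ne_top _) hA
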